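/- If a simple graph G is an interval graph containing no induced subgraph isomorphic to the claw K_{1,3}, then G has a proper interval representation. -/

import Mathlib

/-- `l, r` give an interval representation of the simple graph `G`: each vertex `v` is
assigned the closed interval `[l v, r v]`, and two distinct vertices are adjacent if and
only if the corresponding intervals intersect. -/
def IsIntervalRep {V : Type*} (G : SimpleGraph V) (l r : V → ℝ) : Prop :=
  (∀ v, l v ≤ r v) ∧
    ∀ x y : V, x ≠ y →
      (G.Adj x y ↔ (Set.Icc (l x) (r x) ∩ Set.Icc (l y) (r y)).Nonempty)

/-- A unit interval representation: an interval representation in which all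
intervals have length 1. -/
def IsUnitIntervalRep {V : Type*} (G : SimpleGraph V) (l r : V → ℝ) : Prop :=
  IsIntervalRep G l r ∧ ∀ v, r v = l v + 1

/-- A proper interval representation: an interval representation in which no interval
is properly contained in another. -/
def IsProperIntervalRep {V : Type*} (G : SimpleGraph V) (l r : V → ℝ) : Prop :=
  IsIntervalRep G l r ∧ ∀ x y : V, ¬ Set.Icc (l x) (r x) ⊂ Set.Icc (l y) (r y)

/-- The claw `K_{1,3}`: the complete bipartite graph with parts of sizes 1 and 3. -/
def claw : SimpleGraph (Fin 1 ⊕ Fin 3) := completeBipartiteGraph (Fin 1) (Fin 3)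

/-- `G` has no induced subgraph isomorphic to the claw `K_{1,3}`
(graph embeddings in Mathlib are induced). -/
def ClawFree {V : Type*} (G : SimpleGraph V) : Prop := IsEmpty (claw ↪g G)

/-- Countably many predicates on a type can be summed into a real function that is monotone for
the preorder they induce and separates every pair of points that they separate. -/
theorem exists_real_of_countable_cuts {M ι : Type*} [Countable ι] (p : ι → M → Prop) :
    ∃ f : M → ℝ, ∀ a b, (∀ i, p i a → p i b) →
      f a ≤ f b ∧ ∀ i, p i b → ¬ p i a → f a < f b := by
  classical
  obtain ⟨_⟩ := nonempty_encodable ι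
  let g : M → ι → ℝ := fun a i => if p i a then (1 / 2 : ℝ) ^ Encodable.encode i else 0
  have hs : ∀ a, Summable (g a) := fun a =>
    Summable.of_nonneg_of_le (fun i => by dsimp only [g]; split_ifs <;> positivity)
      (fun i => by
        rw [Function.comp_apply]
        dsimp only [g]
        split_ifs
        exacts [le_rfl, by positivity])
      (summable_geometric_two.comp_injective Encodable.encode_injective)
  refine ⟨fun a => ∑' i, g a i, fun a b hab => ?_⟩
  have hle : g a ≤ g b := by
    intro i
    dsimp only [g]
    split_ifs with h₁ h₂
    · exact le_rfl
    · exact absurd (hab i h₁) h₂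
    · positivity
    · exact le_rfl
  refine ⟨(hs a).tsum_le_tsum hle (hs b), fun i hb ha => ?_⟩
  refine Summable.tsum_lt_tsum (i := i) hle ?_ (hs a) (hs b)
  simp [g, hb, ha]

/-- The trace of the interval order of the intervals `[l v, r v]`: every interval to the left of
`x` is to the left of `y`, and every interval to the right of `y` is to the right of `x`. -/
def IntervalTrace {V : Type*} (l r : V → ℝ) (x y : V) : Prop :=
  (∀ z, r z < l x → r z < l y) ∧ ∀ z, r y < l z → r x < l z

/-- Upper sets, indexed by three copies of `ℚ`, in the disjoint union of formal left endpoints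
`Sum.inl v` and formal right endpoints `Sum.inr v`. -/
def endpointCut {V : Type*} (l r : V → ℝ) : ℚ ⊕ ℚ ⊕ ℚ → V ⊕ V → Prop
  | .inl q, .inl v => ∃ a, q < l a ∧ IntervalTrace l r a v
  | .inl q, .inr v => ∃ a, q < l a ∧ l a ≤ r v
  | .inr (.inl q), .inl v => ∃ a, q < l a ∧ l a ≤ r v
  | .inr (.inl q), .inr v => ∃ w, (∃ a, q < l a ∧ l a ≤ r w) ∧ l w ≤ r v
  | .inr (.inr q), .inl v => ∃ w, (∃ a, q < l a ∧ IntervalTrace l r a w) ∧ r w < l v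
  | .inr (.inr q), .inr v => ∃ a, q < l a ∧ IntervalTrace l r a v

namespace IntervalTrace

variable {V : Type*} {l r : V → ℝ} {x y z : V}

theorem refl (x : V) : IntervalTrace l r x x := ⟨fun _ h => h, fun _ h => h⟩

theorem trans (h₁ : IntervalTrace l r x y) (h₂ : IntervalTrace l r y z) :
    IntervalTrace l r x z :=
  ⟨fun w h => h₂.1 w (h₁.1 w h), fun w h => h₁.2 w (h₂.2 w h)⟩

theorem left_le_right (h : IntervalTrace l r x y) (hyz : l y ≤ r z) : l x ≤ r z :=
  not_lt.1 fun hlt => hyz.not_gt (h.1 z hlt)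

theorem right_le_right (h : IntervalTrace l r x y) (hzx : l z ≤ r x) : l z ≤ r y :=
  not_lt.1 fun hlt => hzx.not_gt (h.2 z hlt)

theorem endpointCut_inl (h : IntervalTrace l r x y) (i : ℚ ⊕ ℚ ⊕ ℚ) :
    endpointCut l r i (.inl x) → endpointCut l r i (.inl y) := by
  rcases i with q | q | q
  · rintro ⟨a, ha, hax⟩
    exact ⟨a, ha, hax.trans h⟩
  · rintro ⟨a, ha, hax⟩
    exact ⟨a, ha, h.right_le_right hax⟩
  · rintro ⟨w, hw, hwx⟩
    exact ⟨w, hw, h.1 w hwx⟩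

theorem endpointCut_inr (h : IntervalTrace l r x y) (i : ℚ ⊕ ℚ ⊕ ℚ) :
    endpointCut l r i (.inr x) → endpointCut l r i (.inr y) := by
  rcases i with q | q | q
  · rintro ⟨a, ha, hax⟩
    exact ⟨a, ha, h.right_le_right hax⟩
  · rintro ⟨w, hw, hwx⟩
    exact ⟨w, hw, h.right_le_right hwx⟩
  · rintro ⟨a, ha, hax⟩
    exact ⟨a, ha, hax.trans h⟩

end IntervalTrace

/-- No interval meets three pairwise disjoint ones: the interval order is a semiorder. -/
def IsSemiorderRep {V : Type*} (l r : V → ℝ) : Prop :=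
  ∀ x y z w, r x < l y → r y < l z → l w ≤ r x → r w < l z

theorem IsIntervalRep.adj_iff {V : Type*} {G : SimpleGraph V} {l r : V → ℝ}
    (h : IsIntervalRep G l r) {x y : V} (hxy : x ≠ y) :
    G.Adj x y ↔ l x ≤ r y ∧ l y ≤ r x := by
  rw [h.2 x y hxy, Set.Icc_inter_Icc, Set.nonempty_Icc]
  have := h.1 x
  have := h.1 y
  simp only [sup_le_iff, le_inf_iff]
  tauto

theorem IsIntervalRep.isSemiorderRep {V : Type*} {G : SimpleGraph V} {l r : V → ℝ}
    (h : IsIntervalRep G l r) (hG : ClawFree G) : IsSemiorderRep l r := by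
  intro x y z w hxy hyz hwx
  by_contra! hwz
  have hx := h.1 x
  have hy := h.1 y
  have hz := h.1 z
  have disj : ∀ {u v : V}, r u < l v → u ≠ v ∧ ¬ G.Adj u v ∧ ¬ G.Adj v u := by
    intro u v huv
    have hne : u ≠ v := by
      rintro rfl
      exact (h.1 u).not_gt huv
    refine ⟨hne, fun hadj => ?_, fun hadj => ?_⟩
    · exact ((h.adj_iff hne).1 hadj).2.not_gt huv
    · exact ((h.adj_iff hne.symm).1 hadj).1.not_gt huv
  have meet : ∀ {v : V}, w ≠ v → l w ≤ r v → l v ≤ r w → G.Adj w v ∧ G.Adj v w :=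
    fun hne h₁ h₂ => ⟨(h.adj_iff hne).2 ⟨h₁, h₂⟩, (h.adj_iff hne.symm).2 ⟨h₂, h₁⟩⟩
  obtain ⟨hxy', nxy, nyx⟩ := disj hxy
  obtain ⟨hyz', nyz, nzy⟩ := disj hyz
  obtain ⟨hxz', nxz, nzx⟩ := disj (show r x < l z by linarith)
  have hwx' : w ≠ x := by rintro rfl; linarith
  have hwy' : w ≠ y := by rintro rfl; linarith
  have hwz' : w ≠ z := by rintro rfl; linarith
  obtain ⟨awx, axw⟩ := meet hwx' hwx (by linarith)
  obtain ⟨awy, ayw⟩ := meet hwy' (by linarith) (by linarith)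
  obtain ⟨awz, azw⟩ := meet hwz' (by linarith) hwz
  refine hG.false ⟨⟨Sum.elim (fun _ => w) ![x, y, z], ?_⟩, ?_⟩
  · rintro (a | a) (b | b) <;> fin_cases a <;> fin_cases b <;>
      simp [hwx', hwy', hwz', hxy', hyz', hxz', hwx'.symm, hwy'.symm, hwz'.symm, hxy'.symm,
        hyz'.symm, hxz'.symm]
  · intro a b
    change G.Adj (Sum.elim (fun _ => w) ![x, y, z] a) (Sum.elim (fun _ => w) ![x, y, z] b) ↔ _
    rcases a with a | a <;> rcases b with b | b <;> fin_cases a <;> fin_cases b <;>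
      simp [claw, *]

namespace IsSemiorderRep

variable {V : Type*} {l r : V → ℝ} {x y z : V}

theorem intervalTrace_of_le_of_lt (h : IsSemiorderRep l r)
    (hxy : l x ≤ r y) (hyz : r y < l z) : IntervalTrace l r x z :=
  ⟨fun _ hw => hw.trans_le (hxy.trans hyz.le), fun w hw => h y z w x hyz hw hxy⟩

theorem intervalTrace_of_lt_of_le (h : IsSemiorderRep l r)
    (hxy : r x < l y) (hyz : l y ≤ r z) : IntervalTrace l r x z :=
  ⟨fun w hw => not_le.1 fun hzw => hyz.not_gt (h w x y z hw hxy hzw),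
    fun _ hw => hxy.trans_le (hyz.trans hw.le)⟩

theorem intervalTrace_total (h : IsSemiorderRep l r) (x y : V) :
    IntervalTrace l r x y ∨ IntervalTrace l r y x := by
  by_contra! hxy
  simp only [IntervalTrace, not_and_or, not_forall, not_lt] at hxy
  obtain ⟨⟨a, ha, ha'⟩ | ⟨a, ha, ha'⟩, ⟨b, hb, hb'⟩ | ⟨b, hb, hb'⟩⟩ := hxy
  · linarith
  · exact hb'.not_gt (h a x b y ha hb ha')
  · exact ha'.not_gt (h b y a x hb ha hb')
  · linarith

theorem endpointCut_inl_inr (h : IsSemiorderRep l r) (hyx : l y ≤ r x) (i : ℚ ⊕ ℚ ⊕ ℚ) :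
    endpointCut l r i (.inl y) → endpointCut l r i (.inr x) := by
  rcases i with q | q | q
  · rintro ⟨a, ha, hay⟩
    exact ⟨a, ha, hay.left_le_right hyx⟩
  · exact fun hy => ⟨y, hy, hyx⟩
  · rintro ⟨w, ⟨a, ha, haw⟩, hwy⟩
    exact ⟨a, ha, haw.trans (h.intervalTrace_of_lt_of_le hwy hyx)⟩

theorem endpointCut_inr_inl (h : IsSemiorderRep l r) (hxy : r x < l y) (i : ℚ ⊕ ℚ ⊕ ℚ) :
    endpointCut l r i (.inr x) → endpointCut l r i (.inl y) := by
  rcases i with q | q | q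
  · rintro ⟨a, ha, hax⟩
    exact ⟨a, ha, h.intervalTrace_of_le_of_lt hax hxy⟩
  · rintro ⟨w, ⟨a, ha, haw⟩, hwx⟩
    exact ⟨a, ha, (h.intervalTrace_of_le_of_lt hwx hxy).right_le_right haw⟩
  · exact fun hx => ⟨x, hx, hxy⟩

end IsSemiorderRep

theorem exists_endpointCut_of_lt {V : Type*} {l r : V → ℝ} {x y : V} (hxy : r x < l y) :
    ∃ q : ℚ, endpointCut l r (.inl q) (.inl y) ∧ ¬ endpointCut l r (.inl q) (.inr x) := by
  obtain ⟨q, hxq, hqy⟩ := exists_rat_btwn hxy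
  refine ⟨q, ⟨y, hqy, .refl y⟩, ?_⟩
  rintro ⟨a, hqa, hax⟩
  linarith

/-- A strict inequality in the trace is witnessed by cuts both between the left endpoints and
between the right endpoints. -/
theorem IsSemiorderRep.exists_endpointCut_of_not_intervalTrace {V : Type*} {l r : V → ℝ}
    (h : IsSemiorderRep l r) {x y : V} (hyx : ¬ IntervalTrace l r y x) :
    (∃ i, endpointCut l r i (.inl y) ∧ ¬ endpointCut l r i (.inl x)) ∧
      ∃ i, endpointCut l r i (.inr y) ∧ ¬ endpointCut l r i (.inr x) := by
  simp only [IntervalTrace, not_and_or, not_forall, not_lt] at hyx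
  obtain ⟨z, hzy, hxz⟩ | ⟨z, hxz, hzy⟩ := hyx
  · obtain ⟨q, hy, hz⟩ := exists_endpointCut_of_lt hzy
    have hx := fun hx => hz (h.endpointCut_inl_inr hxz _ hx)
    exact ⟨⟨.inl q, hy, hx⟩, ⟨.inr (.inr q), hy, hx⟩⟩
  · obtain ⟨q, hz, hx⟩ := exists_endpointCut_of_lt hxz
    have hy := h.endpointCut_inl_inr hzy _ hz
    exact ⟨⟨.inr (.inl q), hy, hx⟩, ⟨.inl q, hy, hx⟩⟩

/-- If a simple graph `G` is an interval graph containing no induced subgraph isomorphic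
to the claw `K_{1,3}`, then `G` has a proper interval representation. -/
theorem stmt_2 {V : Type*} (G : SimpleGraph V)
    (hint : ∃ l r : V → ℝ, IsIntervalRep G l r) (hcf : ClawFree G) :
    ∃ l r : V → ℝ, IsProperIntervalRep G l r := by
  obtain ⟨l, r, h⟩ := hint
  have hs := h.isSemiorderRep hcf
  obtain ⟨f, hf⟩ := exists_real_of_countable_cuts (endpointCut l r)
  have hle : ∀ x y, l y ≤ r x → f (.inl y) ≤ f (.inr x) := fun x y hyx =>
    (hf _ _ (hs.endpointCut_inl_inr hyx)).1
  have hlt : ∀ x y, r x < l y → f (.inr x) < f (.inl y) := fun x y hxy =>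
    have ⟨q, hy, hx⟩ := exists_endpointCut_of_lt hxy
    (hf _ _ (hs.endpointCut_inr_inl hxy)).2 (.inl q) hy hx
  have hiff : ∀ x y, f (.inl y) ≤ f (.inr x) ↔ l y ≤ r x := fun x y =>
    ⟨fun hyx => not_lt.1 fun hxy => hyx.not_gt (hlt x y hxy), hle x y⟩
  have hfle : ∀ v, f (.inl v) ≤ f (.inr v) := fun v => hle v v (h.1 v)
  refine ⟨fun v => f (.inl v), fun v => f (.inr v), ⟨hfle, fun x y hxy => ?_⟩, fun x y hxy => ?_⟩
  · rw [h.adj_iff hxy, Set.Icc_inter_Icc, Set.nonempty_Icc, sup_le_iff, le_inf_iff, le_inf_iff,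
      hiff, hiff, hiff, hiff]
    have := h.1 x
    have := h.1 y
    tauto
  · obtain ⟨hyx₁, hxy₂⟩ := (Set.Icc_subset_Icc_iff (hfle x)).1 hxy.1
    have htr : IntervalTrace l r x y ∧ IntervalTrace l r y x := by
      by_contra hne
      rcases hs.intervalTrace_total x y with ht | ht
      · obtain ⟨⟨i, hi, hi'⟩, -⟩ :=
          hs.exists_endpointCut_of_not_intervalTrace fun ht' => hne ⟨ht, ht'⟩
        exact hyx₁.not_gt ((hf _ _ ht.endpointCut_inl).2 i hi hi')
      · obtain ⟨-, i, hi, hi'⟩ :=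
          hs.exists_endpointCut_of_not_intervalTrace fun ht' => hne ⟨ht', ht⟩
        exact hxy₂.not_gt ((hf _ _ ht.endpointCut_inr).2 i hi hi')
    exact hxy.2 (Set.Icc_subset_Icc (hf _ _ htr.1.endpointCut_inl).1
      (hf _ _ htr.2.endpointCut_inr).1)
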